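/- arXiv:math/0508372 — 2 statements merged into one kernel-verified Lean document; each statement's English description precedes it below -/
import Mathlib

section
/- Suppose in addition that each V p is a real inner product space, and that for every p there are subspaces A p, K p, B p of V p such that: V p = A p ⊕ K p ⊕ B p is an internal direct sum with A p, K p, B p pairwise orthogonal; K p = ker (d p) ∩ ker (δ p); A p ⊆ range (δ (p+1)); B p ⊆ range (d (p−1)); ker (d p) = K p ⊕ B p; and ker (δ p) = A p ⊕ K p. Suppose further that for every p there are finite-dimensional subspaces Wn p and Wd p of K p such that K p = Wn p ⊕ (range (d (p−1)) ∩ K p) and K p = (range (δ (p+1)) ∩ K p) ⊕ Wd p are orthogonal internal direct sums, and Wn p ∩ Wd p = {0}. Then for every p the Laplacian Δ p : V p → V p is surjective. (This is the abstract form of Lemma 1; on a compact connected oriented Riemannian manifold with non-empty boundary the hypotheses are supplied by the Hodge Decomposition Theorem, with A = co-exact forms from Neumann forms, K = closed and co-closed forms, B = exact forms from Dirichlet forms, Wn ≅ H^p(M;ℝ), Wd ≅ H^p(M,∂M;ℝ), and Wn ∩ Wd = 0 by Lemma 2.) -/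
/-- Transport along an equality of indices, as a linear map (the identity map). -/
def lcast (V : ℤ → Type*) [∀ p, AddCommGroup (V p)] [∀ p, Module ℝ (V p)]
    {p q : ℤ} (h : p = q) : V p →ₗ[ℝ] V q := by
  subst h; exact LinearMap.id

/-- The differential `d (p-1)`, regarded as a linear map into `V p`. -/
def dTo (V : ℤ → Type*) [∀ p, AddCommGroup (V p)] [∀ p, Module ℝ (V p)]
    (d : ∀ p : ℤ, V p →ₗ[ℝ] V (p + 1)) (p : ℤ) : V (p - 1) →ₗ[ℝ] V p :=
  (lcast V (by omega)).comp (d (p - 1))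

/-- The codifferential `δ (p+1)`, regarded as a linear map into `V p`. -/
def deltaTo (V : ℤ → Type*) [∀ p, AddCommGroup (V p)] [∀ p, Module ℝ (V p)]
    (δ : ∀ p : ℤ, V p →ₗ[ℝ] V (p - 1)) (p : ℤ) : V (p + 1) →ₗ[ℝ] V p :=
  (lcast V (by omega)).comp (δ (p + 1))

/-- The Laplacian `Δ p = d (p-1) ∘ δ p + δ (p+1) ∘ d p : V p →ₗ[ℝ] V p`. -/
def Lap (V : ℤ → Type*) [∀ p, AddCommGroup (V p)] [∀ p, Module ℝ (V p)]
    (d : ∀ p : ℤ, V p →ₗ[ℝ] V (p + 1)) (δ : ∀ p : ℤ, V p →ₗ[ℝ] V (p - 1))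
    (p : ℤ) : V p →ₗ[ℝ] V p :=
  ((dTo V d p).comp (δ p)) + ((deltaTo V δ p).comp (d p))

open RealInnerProductSpace

section helpers

variable (V : ℤ → Type*) [∀ p, AddCommGroup (V p)] [∀ p, Module ℝ (V p)]

theorem d_lcast_d (d : ∀ p : ℤ, V p →ₗ[ℝ] V (p + 1))
    (hd : ∀ p : ℤ, (d (p + 1)).comp (d p) = 0) {r q : ℤ} (h : r + 1 = q) (z : V r) :
    d q (lcast V h (d r z)) = 0 := by
  subst h
  exact LinearMap.congr_fun (hd r) z

theorem delta_lcast_delta (δ : ∀ p : ℤ, V p →ₗ[ℝ] V (p - 1))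
    (hδ : ∀ p : ℤ, (δ (p - 1)).comp (δ p) = 0) {r q : ℤ} (h : r - 1 = q) (z : V r) :
    δ q (lcast V h (δ r z)) = 0 := by
  subst h
  exact LinearMap.congr_fun (hδ r) z

theorem lcast_d (d : ∀ p : ℤ, V p →ₗ[ℝ] V (p + 1)) {r q : ℤ} (h : r = q)
    (h' : r + 1 = q + 1) (z : V r) : lcast V h' (d r z) = d q (lcast V h z) := by
  subst h
  rfl

theorem lcast_delta (δ : ∀ p : ℤ, V p →ₗ[ℝ] V (p - 1)) {r q : ℤ} (h : r = q)
    (h' : r - 1 = q - 1) (z : V r) : lcast V h' (δ r z) = δ q (lcast V h z) := by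
  subst h
  rfl

theorem lap_surj_of_span (d : ∀ p : ℤ, V p →ₗ[ℝ] V (p + 1)) (δ : ∀ p : ℤ, V p →ₗ[ℝ] V (p - 1))
    (hd : ∀ p : ℤ, (d (p + 1)).comp (d p) = 0)
    (hδ : ∀ p : ℤ, (δ (p - 1)).comp (δ p) = 0)
    (hs : ∀ p : ℤ, ∀ v : V p, ∃ y x, dTo V d p y + deltaTo V δ p x = v) (p : ℤ) :
    Function.Surjective (Lap V d δ p) := by
  have F1 : ∀ p y, d p (dTo V d p y) = 0 := fun p y => d_lcast_d V d hd _ y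
  have F3 : ∀ p y, δ p (deltaTo V δ p y) = 0 := fun p y => delta_lcast_delta V δ hδ _ y
  have F2 : ∀ z, dTo V d p (dTo V d (p - 1) z) = 0 := fun z => by
    rw [dTo, LinearMap.comp_apply, F1, map_zero]
  have F4 : ∀ z, deltaTo V δ p (deltaTo V δ (p + 1) z) = 0 := fun z => by
    rw [deltaTo, LinearMap.comp_apply, F3, map_zero]
  have F5 : ∀ a, deltaTo V δ (p - 1) a = δ p (lcast V (by omega) a) := fun a =>
    lcast_delta V δ _ _ a
  have F6 : ∀ a, dTo V d (p + 1) a = d p (lcast V (by omega) a) := fun a =>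
    lcast_d V d _ _ a
  have D : ∀ u, ∃ v, Lap V d δ p v = dTo V d p u := by
    intro u
    obtain ⟨z, a, rfl⟩ := hs (p - 1) u
    rw [map_add, F2, zero_add, F5]
    obtain ⟨y, x, h⟩ := hs p (lcast V (by omega) a)
    refine ⟨dTo V d p y, ?_⟩
    rw [← h, map_add (δ p), F3, add_zero]
    simp [Lap, F1]
  have E : ∀ u, ∃ v, Lap V d δ p v = deltaTo V δ p u := by
    intro u
    obtain ⟨a, z, rfl⟩ := hs (p + 1) u
    rw [map_add, F4, add_zero, F6]
    obtain ⟨y, x, h⟩ := hs p (lcast V (by omega) a)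
    refine ⟨deltaTo V δ p x, ?_⟩
    rw [← h, map_add (d p), F1, zero_add]
    simp [Lap, F3]
  intro v
  obtain ⟨y, x, rfl⟩ := hs p v
  obtain ⟨v₁, h₁⟩ := D y
  obtain ⟨v₂, h₂⟩ := E x
  exact ⟨v₁ + v₂, by rw [map_add, h₁, h₂]⟩

end helpers

theorem sup_of_orth {H : Type*} [NormedAddCommGroup H] [InnerProductSpace ℝ H]
    (K E C N D : Submodule ℝ H) [FiniteDimensional ℝ N]
    (hN : N ⊔ E = K) (hNo : ∀ x ∈ N, ∀ y ∈ E, ⟪x, y⟫ = 0)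
    (hD : C ⊔ D = K) (hDo : ∀ x ∈ C, ∀ y ∈ D, ⟪x, y⟫ = 0)
    (hND : N ⊓ D = ⊥) : K ≤ E ⊔ C := by
  have key : N ≤ C.map (N.starProjection : H →ₗ[ℝ] H) := by
    set Q := C.map (N.starProjection : H →ₗ[ℝ] H) with hQ
    have hQN : Q ≤ N := by
      rintro _ ⟨c, -, rfl⟩
      exact N.starProjection_apply_mem c
    haveI : FiniteDimensional ℝ Q := Submodule.finiteDimensional_of_le hQN
    intro w hw
    have hq : Q.starProjection w ∈ Q := Q.starProjection_apply_mem w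
    have hr : w - Q.starProjection w ∈ Qᗮ := Q.sub_starProjection_mem_orthogonal w
    have hrN : w - Q.starProjection w ∈ N := N.sub_mem hw (hQN hq)
    generalize hrd : w - Q.starProjection w = r at hr hrN
    have hrC : ∀ c ∈ C, ⟪r, c⟫ = 0 := by
      intro c hc
      have h1 : ⟪N.starProjection c, r⟫ = 0 := hr _ ⟨c, hc, rfl⟩
      have h2 : ⟪r, c - N.starProjection c⟫ = 0 :=
        N.sub_starProjection_mem_orthogonal c r hrN
      rw [inner_sub_right, real_inner_comm, real_inner_comm _ r] at h2
      rw [real_inner_comm]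
      linarith
    have hrK : r ∈ C ⊔ D := by
      rw [hD, ← hN]; exact Submodule.mem_sup_left hrN
    obtain ⟨c, hc, t, ht, hct⟩ := Submodule.mem_sup.1 hrK
    have h1 := hrC c hc
    rw [← hct, inner_add_left, real_inner_comm, hDo c hc t ht |> (real_inner_comm _ _).trans,
      add_zero, inner_self_eq_zero] at h1
    rw [h1, zero_add] at hct
    have : r ∈ N ⊓ D := ⟨hrN, hct ▸ ht⟩
    rw [hND, Submodule.mem_bot] at this
    rw [this, sub_eq_zero] at hrd
    rw [hrd]; exact hq
  intro k hk
  rw [← hN] at hk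
  obtain ⟨w, hw, e, he, rfl⟩ := Submodule.mem_sup.1 hk
  obtain ⟨c, hc, hcw⟩ := key hw
  have hcK : c ∈ N ⊔ E := by rw [hN, ← hD]; exact Submodule.mem_sup_left hc
  obtain ⟨w', hw', e', he', hce⟩ := Submodule.mem_sup.1 hcK
  have hP : N.starProjection c = w' := by
    refine Submodule.eq_starProjection_of_mem_of_inner_eq_zero hw' ?_
    intro n hn
    rw [← hce, add_sub_cancel_left, real_inner_comm]
    exact hNo n hn e' he'
  have hww : w = w' := hcw.symm.trans hP
  refine Submodule.mem_sup.2 ⟨e - e', E.sub_mem he he', c, hc, ?_⟩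
  rw [hww, ← hce]; abel

/-- **Lemma 1 (abstract form).**  Suppose each `V p` is a real inner product space with an
orthogonal Hodge-type decomposition `V p = A p ⊕ K p ⊕ B p`, where
`K p = ker (d p) ∩ ker (δ p)`, `A p` consists of co-exact elements, `B p` of exact elements,
`ker (d p) = K p ⊕ B p`, `ker (δ p) = A p ⊕ K p`; and suppose `K p` splits orthogonally both
as `Wn p ⊕ (range (d (p-1)) ∩ K p)` and as `(range (δ (p+1)) ∩ K p) ⊕ Wd p` with `Wn p`,
`Wd p` finite-dimensional and `Wn p ∩ Wd p = 0`.  Then the Laplacian `Δ p` is surjective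
for every `p`. -/
theorem laplacian_surjective
    (V : ℤ → Type*) [∀ p, NormedAddCommGroup (V p)] [∀ p, InnerProductSpace ℝ (V p)]
    (d : ∀ p : ℤ, V p →ₗ[ℝ] V (p + 1)) (δ : ∀ p : ℤ, V p →ₗ[ℝ] V (p - 1))
    (hd : ∀ p : ℤ, (d (p + 1)).comp (d p) = 0)
    (hδ : ∀ p : ℤ, (δ (p - 1)).comp (δ p) = 0)
    (A K B : ∀ p : ℤ, Submodule ℝ (V p))
    -- `V p = A p ⊕ K p ⊕ B p`, an internal direct sum of pairwise orthogonal subspaces: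
    (hAKB : ∀ p : ℤ, A p ⊔ K p ⊔ B p = ⊤)
    (hAK : ∀ p : ℤ, ∀ x ∈ A p, ∀ y ∈ K p, ⟪x, y⟫ = 0)
    (hAB : ∀ p : ℤ, ∀ x ∈ A p, ∀ y ∈ B p, ⟪x, y⟫ = 0)
    (hKB : ∀ p : ℤ, ∀ x ∈ K p, ∀ y ∈ B p, ⟪x, y⟫ = 0)
    -- `K p` is the space of closed and co-closed elements:
    (hK : ∀ p : ℤ, K p = LinearMap.ker (d p) ⊓ LinearMap.ker (δ p))
    -- `A p` is co-exact and `B p` is exact: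
    (hA : ∀ p : ℤ, A p ≤ LinearMap.range (deltaTo V δ p))
    (hB : ∀ p : ℤ, B p ≤ LinearMap.range (dTo V d p))
    -- `ker (d p) = K p ⊕ B p` and `ker (δ p) = A p ⊕ K p`:
    (hkerd : ∀ p : ℤ, LinearMap.ker (d p) = K p ⊔ B p)
    (hkerδ : ∀ p : ℤ, LinearMap.ker (δ p) = A p ⊔ K p)
    (Wn Wd : ∀ p : ℤ, Submodule ℝ (V p))
    (hWnK : ∀ p : ℤ, Wn p ≤ K p) (hWdK : ∀ p : ℤ, Wd p ≤ K p)
    (hWnfin : ∀ p : ℤ, FiniteDimensional ℝ (Wn p))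
    (hWdfin : ∀ p : ℤ, FiniteDimensional ℝ (Wd p))
    -- `K p = Wn p ⊕ (range (d (p-1)) ∩ K p)`, an orthogonal internal direct sum:
    (hKn : ∀ p : ℤ, Wn p ⊔ (LinearMap.range (dTo V d p) ⊓ K p) = K p)
    (hKnorth : ∀ p : ℤ, ∀ x ∈ Wn p, ∀ y ∈ LinearMap.range (dTo V d p) ⊓ K p, ⟪x, y⟫ = 0)
    -- `K p = (range (δ (p+1)) ∩ K p) ⊕ Wd p`, an orthogonal internal direct sum:
    (hKd : ∀ p : ℤ, (LinearMap.range (deltaTo V δ p) ⊓ K p) ⊔ Wd p = K p)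
    (hKdorth : ∀ p : ℤ, ∀ x ∈ LinearMap.range (deltaTo V δ p) ⊓ K p, ∀ y ∈ Wd p, ⟪x, y⟫ = 0)
    -- `Wn p ∩ Wd p = 0`:
    (hWnWd : ∀ p : ℤ, Wn p ⊓ Wd p = ⊥) :
    ∀ p : ℤ, Function.Surjective (Lap V d δ p) := by
  refine lap_surj_of_span V d δ hd hδ ?_
  intro p v
  have hfin := hWnfin p
  have hk := sup_of_orth (K p) _ _ (Wn p) (Wd p) (hKn p) (hKnorth p) (hKd p) (hKdorth p) (hWnWd p)
  have htop : (⊤ : Submodule ℝ (V p)) ≤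
      LinearMap.range (dTo V d p) ⊔ LinearMap.range (deltaTo V δ p) := by
    rw [← hAKB p]
    refine sup_le (sup_le ((hA p).trans le_sup_right) (hk.trans ?_)) ((hB p).trans le_sup_left)
    exact sup_le_sup inf_le_left inf_le_left
  obtain ⟨_, ⟨y, rfl⟩, _, ⟨x, rfl⟩, h⟩ := Submodule.mem_sup.1 (htop (Submodule.mem_top (x := v)))
  exact ⟨y, x, h⟩
end

section
/- Let n ≥ 2, let U ⊆ ℝⁿ be open and connected, and let v : ℝⁿ → ℝⁿ be smooth (C^∞) on U. Assume v is curl-free on U (∂vⱼ/∂xᵢ = ∂vᵢ/∂xⱼ on U for all indices i, j) and divergence-free on U (Σᵢ ∂vᵢ/∂xᵢ = 0 on U), that the set of points of U with last coordinate xₙ = 0 is nonempty, and that v(x) = 0 for every x ∈ U with xₙ = 0. Then v is identically zero on U. (This is the flat-space version of Lemma 2: a closed and co-closed 1-form on a connected region which vanishes on a nonempty piece of a hyperplane must vanish identically, by unique continuation.) -/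
open Real Set Filter Topology
open scoped InnerProductSpace

/-- Second derivative test in one variable. -/
lemma sd_test (g g' : ℝ → ℝ) (a : ℝ) (hg : ∀ᶠ t in 𝓝 (0:ℝ), HasDerivAt g (g' t) t)
    (hg' : HasDerivAt g' a 0) (hmax : IsLocalMax g 0) : a ≤ 0 := by
  by_contra! ha
  have h1 : deriv g =ᶠ[𝓝 0] g' := hg.mono fun t ht => ht.deriv
  have h2 : deriv (deriv g) 0 = a := by rw [h1.deriv_eq]; exact hg'.deriv
  have h3 : IsLocalMin g 0 :=
    isLocalMin_of_deriv_deriv_pos (by rw [h2]; exact ha) hmax.deriv_eq_zero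
      hg.self_of_nhds.continuousAt
  have h4 : g =ᶠ[𝓝 0] fun _ => g 0 := by
    filter_upwards [hmax, h3] with t h5 h6
    exact le_antisymm h5 h6
  have h5 : deriv g =ᶠ[𝓝 0] fun _ => 0 := by
    have := h4.deriv
    filter_upwards [this] with t ht
    rw [ht]; simp
  have h6 := h5.deriv_eq
  rw [h2] at h6
  simp at h6
  linarith

lemma line_derivs {E : Type*} [NormedAddCommGroup E] [NormedSpace ℝ E] {f : E → ℝ} {y w : E}
    (hf : ContDiffAt ℝ 2 f y) :
    (∀ᶠ t in 𝓝 (0:ℝ), HasDerivAt (fun t : ℝ => f (y + t • w)) (fderiv ℝ f (y + t • w) w) t) ∧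
    HasDerivAt (fun t : ℝ => fderiv ℝ f (y + t • w) w) (fderiv ℝ (fderiv ℝ f) y w w) 0 := by
  have hl : ∀ t : ℝ, HasDerivAt (fun t : ℝ => y + t • w) w t := fun t => by
    simpa using ((hasDerivAt_id t).smul_const w).const_add y
  constructor
  · have h1 : ∀ᶠ z in 𝓝 y, DifferentiableAt ℝ f z := by
      filter_upwards [hf.eventually (by simp)] with z hz
      exact hz.differentiableAt (by simp)
    have hc : Tendsto (fun t : ℝ => y + t • w) (𝓝 0) (𝓝 y) := by
      simpa using (hl 0).continuousAt.tendsto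
    filter_upwards [hc.eventually h1] with t ht
    exact ht.hasFDerivAt.comp_hasDerivAt t (hl t)
  · have h2 : DifferentiableAt ℝ (fderiv ℝ f) y :=
      (hf.fderiv_right (m := 1) (by norm_num)).differentiableAt (by simp)
    have h3 : HasFDerivAt (fderiv ℝ f) (fderiv ℝ (fderiv ℝ f) y) (y + (0:ℝ) • w) := by
      simpa using h2.hasFDerivAt
    have h4 := h3.comp_hasDerivAt (0:ℝ) (hl 0)
    have := h4.clm_apply (hasDerivAt_const (0:ℝ) w)
    simpa using this

/-- Gradient estimate, one-sided, unit direction. -/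
lemma grad_aux {n : ℕ} {u : EuclideanSpace ℝ (Fin n) → ℝ} {c e : EuclideanSpace ℝ (Fin n)}
    {d M : ℝ} (hd : 0 < d) (hM : 0 < M) (he : ‖e‖ = 1)
    (hu : ∀ x ∈ Metric.closedBall c d, ContDiffAt ℝ 2 u x)
    (hh : ∀ x ∈ Metric.closedBall c d,
      ∀ b : OrthonormalBasis (Fin n) ℝ (EuclideanSpace ℝ (Fin n)),
      ∑ i, fderiv ℝ (fderiv ℝ u) x (b i) (b i) = 0)
    (hb : ∀ x ∈ Metric.closedBall c d, |u x| ≤ M) :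
    fderiv ℝ u c e ≤ (n + 1) * M / d := by
  set R : EuclideanSpace ℝ (Fin n) ≃ₗᵢ[ℝ] EuclideanSpace ℝ (Fin n) := (ℝ ∙ e)ᗮ.reflection with hR
  have hRn : ∀ x, ‖R x‖ = ‖x‖ := fun x => R.norm_map x
  have hmem : ∀ x, ‖x‖ ≤ d → c + x ∈ Metric.closedBall c d := fun x hx => by
    simpa [Metric.mem_closedBall, dist_eq_norm] using hx
  let ψ : EuclideanSpace ℝ (Fin n) → ℝ := fun x =>
    M / d^2 * (inner ℝ x x + (n+1) * d * inner ℝ x e - (n+1) * (inner ℝ x e)^2)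
  let h : EuclideanSpace ℝ (Fin n) → ℝ := fun x => (u (c + x) - u (c + R x)) / 2 - ψ x
  let K : Set (EuclideanSpace ℝ (Fin n)) := {x | ‖x‖ ≤ d ∧ 0 ≤ inner ℝ x e}
  have hKc : IsCompact K := by
    have : K = Metric.closedBall 0 d ∩ {x | 0 ≤ inner ℝ x e} := by
      ext x; simp [K]
    rw [this]
    apply (isCompact_closedBall _ _).inter_right
    exact isClosed_le continuous_const (by fun_prop)
  have hcont : ContinuousOn h K := by
    have hcu : ContinuousOn u (Metric.closedBall c d) := fun x hx =>
      (hu x hx).continuousAt.continuousWithinAt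
    apply ContinuousOn.sub
    · apply ContinuousOn.div_const
      apply ContinuousOn.sub
      · exact hcu.comp (by fun_prop) (fun x hx => hmem x hx.1)
      · exact hcu.comp (Continuous.continuousOn (by fun_prop)) (fun x hx => hmem (R x) (by rw [hRn]; exact hx.1))
    · exact Continuous.continuousOn (by fun_prop)
  have key : ∀ x ∈ K, h x ≤ 0 := by
    obtain ⟨x1, hx1, hmx⟩ := hKc.exists_isMaxOn ⟨0, by simp [K, hd.le]⟩ hcont
    suffices h x1 ≤ 0 from fun x hx => (hmx hx).trans this
    have hie : inner ℝ x1 e ≤ ‖x1‖ := by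
      have := real_inner_le_norm x1 e
      rwa [he, mul_one] at this
    obtain ⟨ha, hb'⟩ := hx1
    rcases hb'.eq_or_lt with h0 | h0
    · have hRx : R x1 = x1 := by
        apply Submodule.reflection_mem_subspace_eq_self
        rw [Submodule.mem_orthogonal_singleton_iff_inner_left]
        exact h0.symm
      simp only [h, ψ, hRx, ← h0]
      have : 0 ≤ M / d^2 * inner ℝ x1 x1 := mul_nonneg (by positivity) real_inner_self_nonneg
      simp only [sub_self]
      nlinarith
    rcases ha.eq_or_lt with h1 | h1
    · have e1 := abs_le.1 (hb _ (hmem x1 ha))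
      have e2 := abs_le.1 (hb _ (hmem (R x1) (by rw [hRn]; exact ha)))
      have e3 : M ≤ ψ x1 := by
        simp only [ψ]
        rw [real_inner_self_eq_norm_sq, h1]
        have : 0 ≤ M / d^2 * ((n+1) * (inner ℝ x1 e * (d - inner ℝ x1 e))) := by
          have : 0 ≤ d - inner ℝ x1 e := by linarith
          positivity
        have e4 : M / d^2 * d^2 = M := by field_simp
        nlinarith
      simp only [h]
      linarith [e1.2, e2.1]
    · exfalso
      have hloc : IsLocalMax h x1 := by
        have : K ∈ 𝓝 x1 := by
          have o : IsOpen {x : EuclideanSpace ℝ (Fin n) | ‖x‖ < d ∧ 0 < inner ℝ x e} :=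
            IsOpen.and (isOpen_lt continuous_norm continuous_const)
              (isOpen_lt continuous_const (Continuous.inner continuous_id continuous_const))
          exact Filter.mem_of_superset (o.mem_nhds ⟨h1, h0⟩) (fun x hx => ⟨hx.1.le, hx.2.le⟩)
        exact hmx.isLocalMax this
      let b := EuclideanSpace.basisFun (Fin n) ℝ
      have hsd : ∀ i, (fderiv ℝ (fderiv ℝ u) (c + x1) (b i) (b i)
          - fderiv ℝ (fderiv ℝ u) (c + R x1) (R (b i)) (R (b i))) / 2
          - M / d^2 * (2 * inner ℝ (b i) (b i) - (n+1) * (2 * (inner ℝ (b i) e)^2)) ≤ 0 := by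
        intro i
        obtain ⟨p1, p2⟩ := line_derivs (w := b i) (hu _ (hmem x1 ha))
        obtain ⟨q1, q2⟩ := line_derivs (w := R (b i)) (hu _ (hmem (R x1) (by rw [hRn]; exact ha)))
        have hψ : ∀ t : ℝ, ψ (x1 + t • b i) = M / d^2 * ((inner ℝ x1 x1 + 2 * t * inner ℝ x1 (b i)
            + t^2 * inner ℝ (b i) (b i)) + (n+1) * d * (inner ℝ x1 e + t * inner ℝ (b i) e)
            - (n+1) * (inner ℝ x1 e + t * inner ℝ (b i) e)^2) := by
          intro t
          simp only [ψ, inner_add_left, inner_add_right, real_inner_smul_left, real_inner_smul_right]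
          rw [real_inner_comm x1 (b i)]
          ring
        have r1 : ∀ t : ℝ, HasDerivAt (fun t : ℝ => ψ (x1 + t • b i))
            (M / d^2 * ((2 * inner ℝ x1 (b i)
            + 2 * t * inner ℝ (b i) (b i)) + (n+1) * d * (inner ℝ (b i) e)
            - (n+1) * (2 * (inner ℝ x1 e + t * inner ℝ (b i) e) * inner ℝ (b i) e))) t := by
          intro t
          simp only [hψ]
          generalize inner ℝ x1 x1 = a1
          generalize inner ℝ x1 (b i) = a2
          generalize inner ℝ (b i) (b i) = a3
          generalize inner ℝ x1 e = a4
          generalize inner ℝ (b i) e = a5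
          have k1 : HasDerivAt (fun t : ℝ => t) 1 t := hasDerivAt_id t
          have := ((((k1.const_mul 2).mul_const a2).const_add a1).add ((k1.pow 2).mul_const a3)).add
            (((k1.mul_const a5).const_add a4).const_mul (((n:ℝ)+1)*d)) |>.sub
            ((((k1.mul_const a5).const_add a4).pow 2).const_mul ((n:ℝ)+1)) |>.const_mul (M/d^2)
          refine this.congr_deriv ?_
          simp
        have r2 : HasDerivAt (fun t : ℝ => (M / d^2 * ((2 * inner ℝ x1 (b i)
            + 2 * t * inner ℝ (b i) (b i)) + (n+1) * d * (inner ℝ (b i) e)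
            - (n+1) * (2 * (inner ℝ x1 e + t * inner ℝ (b i) e) * inner ℝ (b i) e))))
            (M / d^2 * (2 * inner ℝ (b i) (b i) - (n+1) * (2 * (inner ℝ (b i) e)^2))) 0 := by
          generalize inner ℝ x1 (b i) = a2
          generalize inner ℝ (b i) (b i) = a3
          generalize inner ℝ x1 e = a4
          generalize inner ℝ (b i) e = a5
          have k1 : HasDerivAt (fun t : ℝ => t) 1 (0:ℝ) := hasDerivAt_id 0
          have := ((((k1.const_mul 2).mul_const a3).const_add (2*a2)).add_const
            (((n:ℝ)+1)*d*a5)) |>.sub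
            (((((k1.mul_const a5).const_add a4).const_mul 2).mul_const a5).const_mul ((n:ℝ)+1))
            |>.const_mul (M/d^2)
          refine this.congr_deriv ?_
          ring
        refine sd_test (fun t : ℝ => (u (c + x1 + t • b i) - u (c + R x1 + t • R (b i))) / 2
          - ψ (x1 + t • b i)) _ _ ?_ (((p2.sub q2).div_const 2).sub r2) ?_
        · filter_upwards [p1, q1] with t p q
          exact ((p.sub q).div_const 2).sub (r1 t)
        · have hc : Tendsto (fun t : ℝ => x1 + t • b i) (𝓝 0) (𝓝 x1) := by
            have : Continuous (fun t : ℝ => x1 + t • b i) := by fun_prop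
            simpa using this.tendsto 0
          have := hc.eventually hloc
          refine this.mono fun t ht => ?_
          simpa [h, add_assoc] using ht
      have hsum := Finset.sum_nonpos (fun i (_ : i ∈ Finset.univ) => hsd i)
      have t1 := hh _ (hmem x1 ha) b
      have t2 := hh _ (hmem (R x1) (by rw [hRn]; exact ha)) (b.map R)
      simp only [OrthonormalBasis.map_apply] at t2
      have t3 : ∑ i, (inner ℝ (b i) e)^2 = 1 := by
        have := b.sum_sq_norm_inner_right e
        rw [he] at this
        simpa using this
      rw [Finset.sum_sub_distrib, ← Finset.sum_div, Finset.sum_sub_distrib, t1, t2,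
        ← Finset.mul_sum, Finset.sum_sub_distrib, ← Finset.mul_sum, ← Finset.mul_sum,
        ← Finset.mul_sum, t3] at hsum
      have t4 : ∑ i, inner ℝ (b i) (b i) = (n:ℝ) := by
        simp
      rw [t4] at hsum
      have : 0 < M / d^2 := by positivity
      nlinarith
  -- derivative comparison
  have hc : ContDiffAt ℝ 2 u c := hu c (by simp [hd.le])
  have hRe : R e = -e := Submodule.reflection_orthogonalComplement_singleton_eq_neg e
  have hdu : HasFDerivAt u (fderiv ℝ u c) c := (hc.differentiableAt (by simp)).hasFDerivAt
  have d1 : HasDerivAt (fun t : ℝ => u (c + t • e)) (fderiv ℝ u c e) 0 := by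
    have hl : HasDerivAt (fun t : ℝ => c + t • e) e 0 := by
      simpa using ((hasDerivAt_id (0:ℝ)).smul_const e).const_add c
    exact HasFDerivAt.comp_hasDerivAt (0:ℝ) (by simpa using hdu) hl
  have d2 : HasDerivAt (fun t : ℝ => u (c + t • (-e))) (fderiv ℝ u c (-e)) 0 := by
    have hl : HasDerivAt (fun t : ℝ => c + t • (-e)) (-e) 0 := by
      simpa using ((hasDerivAt_id (0:ℝ)).smul_const (-e)).const_add c
    exact HasFDerivAt.comp_hasDerivAt (0:ℝ) (by simpa using hdu) hl
  have d3 : HasDerivAt (fun t : ℝ => (u (c + t • e) - u (c + t • (-e))) / 2) (fderiv ℝ u c e) 0 := by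
    refine ((d1.sub d2).div_const 2).congr_deriv ?_
    simp
  have d4 := d3.tendsto_slope_zero_right
  refine le_of_tendsto d4 ?_
  filter_upwards [Ioo_mem_nhdsGT hd] with t ht
  have hk := key (t • e) ⟨by rw [norm_smul, he]; simpa [abs_of_pos ht.1] using ht.2.le, by
    rw [real_inner_smul_left, real_inner_self_eq_norm_sq, he]; simpa using ht.1.le⟩
  have hee : inner ℝ e e = (1:ℝ) := by rw [real_inner_self_eq_norm_sq, he]; norm_num
  simp only [h, ψ, map_smul, hRe, real_inner_smul_left, real_inner_smul_right, hee] at hk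
  simp only [zero_add, zero_smul, add_zero, sub_self, zero_div, sub_zero, smul_eq_mul]
  rw [inv_mul_le_iff₀ ht.1]
  have : M / d^2 * (t * (t * 1) + (n + 1) * d * (t * 1) - (n + 1) * (t * 1) ^ 2)
     ≤ t * ((n + 1) * M / d) := by
    have e1 : t * ((n + 1) * M / d) = M / d^2 * ((n+1) * d * t) := by field_simp
    rw [e1]
    apply mul_le_mul_of_nonneg_left _ (by positivity)
    have : (0:ℝ) ≤ n := by positivity
    nlinarith [mul_nonneg this (sq_nonneg t)]
  linarith

lemma grad_est {n : ℕ} {u : EuclideanSpace ℝ (Fin n) → ℝ} {c e : EuclideanSpace ℝ (Fin n)}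
    {d M : ℝ} (hd : 0 < d) (hM : 0 < M)
    (hu : ∀ x ∈ Metric.closedBall c d, ContDiffAt ℝ 2 u x)
    (hh : ∀ x ∈ Metric.closedBall c d,
      ∀ b : OrthonormalBasis (Fin n) ℝ (EuclideanSpace ℝ (Fin n)),
      ∑ i, fderiv ℝ (fderiv ℝ u) x (b i) (b i) = 0)
    (hb : ∀ x ∈ Metric.closedBall c d, |u x| ≤ M) :
    |fderiv ℝ u c e| ≤ (n + 1) / d * ‖e‖ * M := by
  rcases eq_or_ne e 0 with rfl | he
  · simp
  have hne : ‖e‖ ≠ 0 := norm_ne_zero_iff.2 he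
  have hpos : 0 < ‖e‖ := norm_pos_iff.2 he
  have h1 : ‖(‖e‖⁻¹ • e)‖ = 1 := by rw [norm_smul, norm_inv, norm_norm, inv_mul_cancel₀ hne]
  have a1 := grad_aux hd hM h1 hu hh hb
  have a2 := grad_aux hd hM (e := -(‖e‖⁻¹ • e)) (by rw [norm_neg, h1]) hu hh hb
  have h2 : fderiv ℝ u c e = ‖e‖ * fderiv ℝ u c (‖e‖⁻¹ • e) := by
    rw [map_smul, smul_eq_mul]; field_simp
  rw [map_neg] at a2
  have h3 : |fderiv ℝ u c (‖e‖⁻¹ • e)| ≤ (n + 1) * M / d := abs_le.2 ⟨by linarith, a1⟩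
  rw [h2, abs_mul, abs_of_pos hpos]
  calc _ ≤ ‖e‖ * ((n + 1) * M / d) := by gcongr
    _ = _ := by ring

/-- Smooth, curl-free, divergence-free systems on `U`. -/
structure GoodSys {n : ℕ} (U : Set (EuclideanSpace ℝ (Fin n)))
    (w : Fin n → EuclideanSpace ℝ (Fin n) → ℝ) : Prop where
  smooth : ∀ i, ContDiffOn ℝ (⊤ : ℕ∞) (w i) U
  curl : ∀ x ∈ U, ∀ i j : Fin n, fderiv ℝ (w j) x (EuclideanSpace.single i 1) =
        fderiv ℝ (w i) x (EuclideanSpace.single j 1)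
  div : ∀ x ∈ U, ∑ i : Fin n, fderiv ℝ (w i) x (EuclideanSpace.single i 1) = 0

lemma fd_apply {E : Type*} [NormedAddCommGroup E] [NormedSpace ℝ E] {f : E → ℝ} {x : E}
    (hf : ContDiffAt ℝ 2 f x) (e w : E) :
    HasFDerivAt (fun y => fderiv ℝ f y e) ((fderiv ℝ (fderiv ℝ f) x).flip e) x ∧
    fderiv ℝ (fun y => fderiv ℝ f y e) x w = fderiv ℝ (fderiv ℝ f) x w e ∧
    fderiv ℝ (fderiv ℝ f) x w e = fderiv ℝ (fderiv ℝ f) x e w := by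
  have h2 : DifferentiableAt ℝ (fderiv ℝ f) x :=
      (hf.fderiv_right (m := 1) (by norm_num)).differentiableAt (by simp)
  have h3 : HasFDerivAt (fun y => fderiv ℝ f y e) ((fderiv ℝ (fderiv ℝ f) x).flip e) x := by
    have := h2.hasFDerivAt.clm_apply (hasFDerivAt_const e x)
    simpa using this
  refine ⟨h3, ?_, ?_⟩
  · rw [h3.fderiv]; rfl
  · exact (hf.isSymmSndFDerivAt (by simp)) w e

lemma GoodSys.c2 {n : ℕ} {U : Set (EuclideanSpace ℝ (Fin n))} (hU : IsOpen U)
    {w : Fin n → EuclideanSpace ℝ (Fin n) → ℝ} (h : GoodSys U w) (i : Fin n)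
    {x : EuclideanSpace ℝ (Fin n)} (hx : x ∈ U) : ContDiffAt ℝ 2 (w i) x :=
  ((h.smooth i).contDiffAt (hU.mem_nhds hx)).of_le
    (WithTop.coe_le_coe.2 (le_top : (2 : ℕ∞) ≤ ⊤))

lemma GoodSys.deriv {n : ℕ} {U : Set (EuclideanSpace ℝ (Fin n))} (hU : IsOpen U)
    {w : Fin n → EuclideanSpace ℝ (Fin n) → ℝ} (h : GoodSys U w)
    (e : EuclideanSpace ℝ (Fin n)) : GoodSys U (fun i x => fderiv ℝ (w i) x e) := by
  refine ⟨fun i => ?_, fun x hx i j => ?_, fun x hx => ?_⟩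
  · exact ((h.smooth i).fderiv_of_isOpen hU (m := (⊤ : ℕ∞)) (by simp)).clm_apply contDiffOn_const
  · obtain ⟨-, a1, a2⟩ := fd_apply (h.c2 hU j hx) e (EuclideanSpace.single i 1)
    obtain ⟨-, b1, b2⟩ := fd_apply (h.c2 hU i hx) e (EuclideanSpace.single j 1)
    rw [a1, a2, b1, b2]
    rw [← (fd_apply (h.c2 hU j hx) (EuclideanSpace.single i 1) e).2.1,
      ← (fd_apply (h.c2 hU i hx) (EuclideanSpace.single j 1) e).2.1]
    have : (fun y => fderiv ℝ (w j) y (EuclideanSpace.single i 1)) =ᶠ[𝓝 x]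
        (fun y => fderiv ℝ (w i) y (EuclideanSpace.single j 1)) := by
      filter_upwards [hU.mem_nhds hx] with y hy
      exact h.curl y hy i j
    rw [this.fderiv_eq]
  · have h1 : ∀ i, fderiv ℝ (fun x => fderiv ℝ (w i) x e) x (EuclideanSpace.single i 1) =
        fderiv ℝ (fun y => fderiv ℝ (w i) y (EuclideanSpace.single i 1)) x e := by
      intro i
      obtain ⟨-, a1, a2⟩ := fd_apply (h.c2 hU i hx) e (EuclideanSpace.single i 1)
      rw [a1, a2, (fd_apply (h.c2 hU i hx) (EuclideanSpace.single i 1) e).2.1]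
    simp only [h1]
    have h2 : (fun y => ∑ i, fderiv ℝ (w i) y (EuclideanSpace.single i 1)) =ᶠ[𝓝 x]
        (fun y => (0:ℝ)) := by
      filter_upwards [hU.mem_nhds hx] with y hy
      exact h.div y hy
    have h3 := h2.fderiv_eq (𝕜 := ℝ)
    rw [fderiv_fun_sum (fun i _ =>
      (fd_apply (h.c2 hU i hx) (EuclideanSpace.single i 1) e).1.differentiableAt)] at h3
    have := congrArg (fun L : EuclideanSpace ℝ (Fin n) →L[ℝ] ℝ => L e) h3
    simpa using this

lemma GoodSys.harm {n : ℕ} {U : Set (EuclideanSpace ℝ (Fin n))} (hU : IsOpen U)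
    {w : Fin n → EuclideanSpace ℝ (Fin n) → ℝ} (h : GoodSys U w) (j : Fin n)
    {x : EuclideanSpace ℝ (Fin n)} (hx : x ∈ U)
    (b : OrthonormalBasis (Fin n) ℝ (EuclideanSpace ℝ (Fin n))) :
    ∑ i, fderiv ℝ (fderiv ℝ (w j)) x (b i) (b i) = 0 := by
  have e1 := congrFun (InnerProductSpace.laplacian_eq_iteratedFDeriv_orthonormalBasis (w j) b) x
  have e2 := congrFun (InnerProductSpace.laplacian_eq_iteratedFDeriv_orthonormalBasis (w j)
    (EuclideanSpace.basisFun (Fin n) ℝ)) x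
  rw [e1] at e2
  simp only [iteratedFDeriv_two_apply, EuclideanSpace.basisFun_apply, Matrix.cons_val_zero,
    Matrix.cons_val_one] at e2
  rw [e2]
  have := (h.deriv hU (EuclideanSpace.single j 1)).div x hx
  rw [← this]
  refine Finset.sum_congr rfl fun i _ => ?_
  rw [← (fd_apply (h.c2 hU j hx) (EuclideanSpace.single i 1) (EuclideanSpace.single i 1)).2.1]
  have : (fun y => fderiv ℝ (w j) y (EuclideanSpace.single i 1)) =ᶠ[𝓝 x]
      (fun y => fderiv ℝ (w i) y (EuclideanSpace.single j 1)) := by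
    filter_upwards [hU.mem_nhds hx] with y hy
    exact h.curl y hy i j
  rw [this.fderiv_eq]

/-- Iterated directional derivative. -/
noncomputable def dirD {n : ℕ} (e : EuclideanSpace ℝ (Fin n))
    (w : Fin n → EuclideanSpace ℝ (Fin n) → ℝ) : ℕ → Fin n → EuclideanSpace ℝ (Fin n) → ℝ
  | 0 => w
  | k + 1 => fun i x => fderiv ℝ (dirD e w k i) x e

lemma GoodSys.dirD {n : ℕ} {U : Set (EuclideanSpace ℝ (Fin n))} (hU : IsOpen U)
    {w : Fin n → EuclideanSpace ℝ (Fin n) → ℝ} (h : GoodSys U w)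
    (e : EuclideanSpace ℝ (Fin n)) (k : ℕ) : GoodSys U (dirD e w k) := by
  induction k with
  | zero => exact h
  | succ k ih => exact ih.deriv hU e

lemma dirD_bound {n : ℕ} {U : Set (EuclideanSpace ℝ (Fin n))} (hU : IsOpen U)
    {w : Fin n → EuclideanSpace ℝ (Fin n) → ℝ} (h : GoodSys U w)
    {e p : EuclideanSpace ℝ (Fin n)} {R M s ε : ℝ} (hR : Metric.closedBall p R ⊆ U)
    (hM : 0 < M) (hs : 0 < s) (hε : 0 < ε) (he : ‖e‖ ≤ ε)
    (hb : ∀ i, ∀ x ∈ Metric.closedBall p R, |w i x| ≤ M) (k : ℕ) :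
    ∀ i, ∀ x ∈ Metric.closedBall p (R - k * s), |dirD e w k i x| ≤ ((n + 1) / s * ε) ^ k * M := by
  induction k with
  | zero => intro i x hx; simpa [dirD] using hb i x (by simpa using hx)
  | succ k ih =>
    intro i x hx
    have hsub : Metric.closedBall x s ⊆ Metric.closedBall p (R - k * s) := by
      apply Metric.closedBall_subset_closedBall'
      rw [Metric.mem_closedBall] at hx
      push_cast at hx
      linarith
    have hsub2 : Metric.closedBall x s ⊆ U := hsub.trans
      ((Metric.closedBall_subset_closedBall (by have : 0 ≤ k * s := by positivity
                                                linarith)).trans hR)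
    have hg := h.dirD hU e k
    have := grad_est (e := e) hs (M := ((n + 1) / s * ε) ^ k * M) (by positivity)
      (fun y hy => hg.c2 hU i (hsub2 hy)) (fun y hy b => hg.harm hU i (hsub2 hy) b)
      (fun y hy => ih i y (hsub hy))
    refine this.trans ?_
    rw [pow_succ']
    calc _ ≤ (n + 1) / s * ε * (((n + 1) / s * ε) ^ k * M) := by gcongr
      _ = _ := by ring

lemma taylor_zero {B : ℝ} (N : ℕ) : ∀ G : ℕ → ℝ → ℝ,
    (∀ k, ∀ t ∈ Icc (0:ℝ) 1, HasDerivAt (G k) (G (k+1) t) t) → (∀ k, G k 0 = 0) →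
    (∀ t ∈ Icc (0:ℝ) 1, |G N t| ≤ B) →
    ∀ t ∈ Icc (0:ℝ) 1, |G 0 t| ≤ B * t ^ N / (N.factorial : ℝ) := by
  induction N with
  | zero => intro G h1 h2 h3 t ht; simpa using h3 t ht
  | succ N ih =>
    intro G h1 h2 h3
    have h4 := ih (fun k => G (k+1)) (fun k => h1 (k+1)) (fun k => h2 (k+1)) h3
    have hBd : ∀ x : ℝ, HasDerivAt (fun t : ℝ => B * t ^ (N+1) / ((N+1).factorial : ℝ))
        (B * x ^ N / (N.factorial : ℝ)) x := by
      intro x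
      have := (((hasDerivAt_id x).pow (N+1)).const_mul B).div_const ((N+1).factorial : ℝ)
      refine this.congr_deriv ?_
      have hN : (N.factorial : ℝ) ≠ 0 := by positivity
      have hN1 : ((N:ℝ) + 1) ≠ 0 := by positivity
      simp [Nat.factorial_succ]
      field_simp
    intro t ht
    have := image_norm_le_of_norm_deriv_right_le_deriv_boundary (f := G 0) (f' := G 1)
      (a := 0) (b := 1)
      (fun x hx => (h1 0 x hx).continuousAt.continuousWithinAt)
      (fun x hx => (h1 0 x (Ico_subset_Icc_self hx)).hasDerivWithinAt)
      (by simp [h2 0]) hBd (fun x hx => h4 x (Ico_subset_Icc_self hx)) ht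
    simpa using this

lemma local_uc {n : ℕ} {U : Set (EuclideanSpace ℝ (Fin n))} (hU : IsOpen U)
    {w : Fin n → EuclideanSpace ℝ (Fin n) → ℝ} (h : GoodSys U w)
    {p : EuclideanSpace ℝ (Fin n)} (hp : p ∈ U) :
    ∃ δ > 0, Metric.ball p δ ⊆ U ∧ ∀ q e, q ∈ Metric.ball p δ → q + e ∈ Metric.ball p δ →
      (∀ k i, dirD e w k i q = 0) → ∀ i, w i (q + e) = 0 := by
  obtain ⟨R, hR, hRU⟩ := Metric.nhds_basis_closedBall.mem_iff.1 (hU.mem_nhds hp)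
  obtain ⟨M, hM, hb⟩ : ∃ M > 0, ∀ i, ∀ x ∈ Metric.closedBall p R, |w i x| ≤ M := by
    have : ∀ i, ∃ C, ∀ x ∈ Metric.closedBall p R, ‖w i x‖ ≤ C := fun i =>
      (isCompact_closedBall p R).exists_bound_of_continuousOn ((h.smooth i).continuousOn.mono hRU)
    choose C hC using this
    refine ⟨∑ i, |C i| + 1, by positivity, fun i x hx => ?_⟩
    have h1 := hC i x hx
    have h2 := Finset.single_le_sum (f := fun i => |C i|) (fun i _ => abs_nonneg _)
      (Finset.mem_univ i)
    rw [Real.norm_eq_abs] at h1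
    have h3 := le_abs_self (C i)
    linarith
  set δ : ℝ := R / (16 * (n + 1)) with hδ
  have hδ0 : 0 < δ := by positivity
  have hδR : δ ≤ R / 2 := by
    rw [hδ]
    apply div_le_div_of_nonneg_left hR.le (by norm_num)
    have : (0:ℝ) ≤ n := by positivity
    linarith
  have hball : Metric.ball p δ ⊆ Metric.closedBall p (R / 2) :=
    Metric.ball_subset_closedBall.trans (Metric.closedBall_subset_closedBall hδR)
  have hballU : Metric.ball p δ ⊆ U :=
    hball.trans ((Metric.closedBall_subset_closedBall (by linarith)).trans hRU)
  refine ⟨δ, hδ0, hballU, fun q e hq hqe hz i => ?_⟩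
  have hseg : ∀ t ∈ Icc (0:ℝ) 1, q + t • e ∈ Metric.ball p δ := by
    intro t ht
    have := (convex_ball p δ).add_smul_sub_mem hq hqe ht
    simpa using this
  have he : ‖e‖ ≤ 2 * δ := by
    have : dist (q + e) q ≤ dist (q + e) p + dist q p := dist_triangle_right _ _ _
    rw [dist_eq_norm, add_sub_cancel_left] at this
    rw [Metric.mem_ball] at hq hqe
    linarith
  have key : ∀ N : ℕ, |w i (q + e)| ≤ (3/4) ^ (N+1) * M := by
    intro N
    have hN : (0:ℝ) < (N:ℝ) + 1 := by positivity
    have bd := dirD_bound hU h (e := e) (s := R / (2 * (N+1))) (ε := 2 * δ) hRU hM (by positivity)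
      (by positivity) he hb (N+1) i
    have hr : R - ((N+1 : ℕ):ℝ) * (R / (2 * (N+1))) = R / 2 := by
      push_cast; field_simp; ring
    rw [hr] at bd
    have hA : ((n:ℝ) + 1) / (R / (2 * (N+1))) * (2 * δ) = (N+1) / 4 := by
      rw [hδ]; field_simp; norm_num
    rw [hA] at bd
    have := taylor_zero (B := (((N:ℝ)+1)/4)^(N+1) * M) (N+1) (fun k t => dirD e w k i (q + t • e))
      (by
        intro k t ht
        have hl : HasDerivAt (fun t : ℝ => q + t • e) e t := by
          simpa using ((hasDerivAt_id t).smul_const e).const_add q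
        have hdf := (((h.dirD hU e k).c2 hU i (hballU (hseg t ht))).differentiableAt
          (by simp)).hasFDerivAt
        exact hdf.comp_hasDerivAt t hl)
      (by intro k; simpa using hz k i)
      (fun t ht => bd _ (hball (hseg t ht))) 1 (by simp)
    simp only [one_smul, one_pow, mul_one] at this
    refine this.trans ?_
    have hexp := Real.pow_div_factorial_le_exp (x := (N:ℝ)+1) hN.le (N+1)
    have hexp2 : Real.exp ((N:ℝ)+1) ≤ 3 ^ (N+1) := by
      have e1 : Real.exp ((N:ℝ)+1) = Real.exp 1 ^ (N+1) := by
        rw [← Real.exp_nat_mul]; push_cast; simp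
      rw [e1]
      have := Real.exp_one_lt_d9
      gcongr
      linarith
    calc _ = (((N:ℝ)+1)^(N+1) / ((N+1).factorial : ℝ)) * ((1/4)^(N+1) * M) := by
            rw [div_pow, div_pow]; ring
      _ ≤ 3 ^ (N+1) * ((1/4)^(N+1) * M) := by gcongr; exact hexp.trans hexp2
      _ = _ := by rw [← mul_assoc, ← mul_pow]; norm_num
  have hlim : Tendsto (fun N : ℕ => ((3:ℝ)/4) ^ (N+1) * M) atTop (𝓝 0) := by
    have := ((tendsto_pow_atTop_nhds_zero_of_lt_one (r := (3:ℝ)/4) (by norm_num)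
      (by norm_num)).comp (tendsto_add_atTop_nat 1)).mul_const M
    simpa using this
  have := ge_of_tendsto' hlim key
  exact abs_nonpos_iff.1 this

lemma GoodSys.normal_zero {n : ℕ} {U : Set (EuclideanSpace ℝ (Fin n))} (hU : IsOpen U)
    {w : Fin n → EuclideanSpace ℝ (Fin n) → ℝ} (h : GoodSys U w) (l : Fin n)
    (hz : ∀ i, ∀ x ∈ U, x l = 0 → w i x = 0) (i : Fin n) (x : EuclideanSpace ℝ (Fin n))
    (hx : x ∈ U) (hxl : x l = 0) :
    fderiv ℝ (w i) x (EuclideanSpace.single l 1) = 0 := by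
  have tang : ∀ i j, j ≠ l → fderiv ℝ (w i) x (EuclideanSpace.single j 1) = 0 := by
    intro i j hj
    obtain ⟨h1, -⟩ := line_derivs (w := EuclideanSpace.single j (1:ℝ)) (h.c2 hU i hx)
    have h2 := h1.self_of_nhds
    have h3 : (fun t : ℝ => w i (x + t • EuclideanSpace.single j (1:ℝ))) =ᶠ[𝓝 0] fun _ => 0 := by
      have hc : Tendsto (fun t : ℝ => x + t • EuclideanSpace.single j (1:ℝ)) (𝓝 0) (𝓝 x) := by
        have : Continuous (fun t : ℝ => x + t • EuclideanSpace.single j (1:ℝ)) := by fun_prop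
        simpa using this.tendsto 0
      filter_upwards [hc.eventually (hU.mem_nhds hx)] with t ht
      exact hz i _ ht (by simp [hxl, hj.symm])
    have h4 := h3.deriv_eq
    rw [h2.deriv] at h4
    simpa using h4
  by_cases hi : i = l
  · subst hi
    have := h.div x hx
    rwa [Finset.sum_eq_single i (fun j _ hj => tang j j hj) (by simp)] at this
  · rw [h.curl x hx l i]
    exact tang l i hi

lemma dirD_zero_of_eventually {n : ℕ} {w : Fin n → EuclideanSpace ℝ (Fin n) → ℝ}
    {q : EuclideanSpace ℝ (Fin n)} (hz : ∀ i, ∀ᶠ x in 𝓝 q, w i x = 0)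
    (e : EuclideanSpace ℝ (Fin n)) (k : ℕ) : ∀ i, ∀ᶠ x in 𝓝 q, dirD e w k i x = 0 := by
  induction k with
  | zero => exact hz
  | succ k ih =>
    intro i
    filter_upwards [(ih i).eventually_nhds] with x hx
    have : dirD e w k i =ᶠ[𝓝 x] fun _ => 0 := hx
    simp [dirD, this.fderiv_eq]

/-- **Lemma 2 (flat version).**  Let `v` be a smooth vector field on an open connected set
`U ⊆ ℝⁿ` (`n ≥ 2`) which is curl-free and divergence-free on `U` (so the 1-form `Σ vᵢ dxᵢ`
is closed and co-closed).  If `v` vanishes at every point of `U` on the hyperplane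
`{xₙ = 0}`, and `U` actually meets that hyperplane, then `v` is identically zero on `U`
(by unique continuation). -/
theorem closed_coclosed_vanishing_on_hyperplane_is_zero
    (n : ℕ) (hn : 2 ≤ n) (U : Set (EuclideanSpace ℝ (Fin n)))
    (hU : IsOpen U) (hUconn : IsConnected U)
    (v : EuclideanSpace ℝ (Fin n) → EuclideanSpace ℝ (Fin n))
    (hv : ContDiffOn ℝ (⊤ : ℕ∞) v U)
    (hcurl : ∀ x ∈ U, ∀ i j : Fin n,
      fderiv ℝ (fun y => v y j) x (EuclideanSpace.single i 1) =
        fderiv ℝ (fun y => v y i) x (EuclideanSpace.single j 1))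
    (hdiv : ∀ x ∈ U, ∑ i : Fin n,
      fderiv ℝ (fun y => v y i) x (EuclideanSpace.single i 1) = 0)
    (hmeets : ∃ x ∈ U, x ⟨n - 1, by omega⟩ = 0)
    (hzero : ∀ x ∈ U, x ⟨n - 1, by omega⟩ = 0 → v x = 0) :
    ∀ x ∈ U, v x = 0 := by
  set l : Fin n := ⟨n - 1, by omega⟩ with hl
  let w : Fin n → EuclideanSpace ℝ (Fin n) → ℝ := fun i x => v x i
  have hw : GoodSys U w := ⟨fun i => by
    have := (contDiffOn_euclidean (n := ((⊤ : ℕ∞) : WithTop ℕ∞))).1 hv i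
    exact this, hcurl, hdiv⟩
  have hvw : ∀ x, v x = 0 ↔ ∀ i, w i x = 0 := fun x =>
    ⟨fun h i => by simp [w, h], fun h => by ext i; exact h i⟩
  let Z : Set (EuclideanSpace ℝ (Fin n)) := interior {x | v x = 0}
  suffices U ⊆ Z from fun x hx => interior_subset (s := {x | v x = 0}) (this hx)
  apply hUconn.isPreconnected.subset_of_closure_inter_subset isOpen_interior
  · obtain ⟨p, hp, hpl⟩ := hmeets
    refine ⟨p, hp, ?_⟩
    obtain ⟨δ, hδ, hsub, hloc⟩ := local_uc hU hw hp
    refine mem_interior_iff_mem_nhds.2 (Filter.mem_of_superset (Metric.ball_mem_nhds p hδ) ?_)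
    intro x hx
    let e : EuclideanSpace ℝ (Fin n) := x l • EuclideanSpace.single l 1
    have hq : x - e ∈ Metric.ball p δ := by
      rw [Metric.mem_ball] at hx ⊢
      refine lt_of_le_of_lt ?_ hx
      rw [EuclideanSpace.dist_eq, EuclideanSpace.dist_eq]
      apply Real.sqrt_le_sqrt
      apply Finset.sum_le_sum
      intro i _
      by_cases hi : i = l
      · subst hi
        simp [e, hpl]
        positivity
      · simp [e, hi]
    have hD : ∀ k i, ∀ y ∈ U, y l = 0 → dirD e w k i y = 0 := by
      intro k
      induction k with
      | zero => exact fun i y hy hyl => (hvw y).1 (hzero y hy hyl) i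
      | succ k ih =>
        intro i y hy hyl
        have := (hw.dirD hU e k).normal_zero hU l ih i y hy hyl
        simp [dirD, e, this]
    have := hloc (x - e) e hq (by simpa using hx)
      (fun k i => hD k i _ (hsub hq) (by simp [e]))
    simp only [sub_add_cancel] at this
    exact (hvw x).2 this
  · rintro p ⟨hpc, hp⟩
    obtain ⟨δ, hδ, hsub, hloc⟩ := local_uc hU hw hp
    obtain ⟨q, hqZ, hqd⟩ := Metric.mem_closure_iff.1 hpc δ hδ
    refine mem_interior_iff_mem_nhds.2 (Filter.mem_of_superset (Metric.ball_mem_nhds p hδ) ?_)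
    intro x hx
    have hq : ∀ i, ∀ᶠ y in 𝓝 q, w i y = 0 := fun i => by
      filter_upwards [mem_interior_iff_mem_nhds.1 hqZ] with y hy
      exact (hvw y).1 hy i
    have := hloc q (x - q) (by rwa [Metric.mem_ball, dist_comm]) (by simpa using hx)
      (fun k i => (dirD_zero_of_eventually hq (x - q) k i).self_of_nhds)
    simp only [add_sub_cancel] at this
    exact (hvw x).2 this
end
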